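/- Let G = (V,E) be a finite connected simple graph that is not a tree, with nullity n = |E| - |V| + 1 ≥ 1. Then Σ_{s ⊆ E} Π_{i ∈ V} f_{deg_s(i)}(γ) = Σ_{l=0}^{n-1} C_{n,l}·γ^{2l} as an identity in ℤ[γ], where C_{n,0} = 2^n and C_{n,l} = Σ_{k=l+1}^{n} C(n,k)·C(k+l-1, 2l) for 1 ≤ l ≤ n-1. -/

import Mathlib

open Polynomial

/-- The polynomials `f₀ = 1`, `f₁ = 0`, `f_{n+1}(x) = x·f_n(x) + f_{n-1}(x)`. -/
noncomputable def isingF : ℕ → Polynomial ℤ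
  | 0 => 1
  | 1 => 0
  | n + 2 => X * isingF (n + 1) + isingF n

/-- The degree of vertex `i` in the spanning subgraph `(V, s)`. -/
def degIn {V : Type*} [DecidableEq V] (s : Finset (Sym2 V)) (i : V) : ℕ :=
  (s.filter (fun e => i ∈ e)).card

/-- The coefficients `C_{n,0} = 2^n` and
`C_{n,l} = Σ_{k=l+1}^{n} C(n,k)·C(k+l-1, 2l)` for `l ≥ 1`. -/
def Cnl (n l : ℕ) : ℤ :=
  if l = 0 then 2 ^ n
  else ∑ k ∈ Finset.Icc (l + 1) n, (n.choose k : ℤ) * ((k + l - 1).choose (2 * l) : ℤ)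

theorem eval_isingF {r a b : ℝ} (hsum : a + b = r) (hmul : a * b = -1) (n : ℕ) :
    (isingF n).eval₂ (Int.castRingHom ℝ) r = (1 + a ^ 2)⁻¹ * a ^ n + (1 + b ^ 2)⁻¹ * b ^ n := by
  have ha : 1 + a ^ 2 ≠ 0 := by positivity
  have hb : 1 + b ^ 2 ≠ 0 := by positivity
  induction n using Nat.twoStepInduction with
  | zero =>
    simp only [isingF, eval₂_one]
    field_simp
    linear_combination (a * b - 1) * hmul
  | one =>
    simp only [isingF, eval₂_zero]
    field_simp
    linear_combination -(a + b) * hmul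
  | more n ih₁ ih₂ =>
    have ha' : a ^ 2 = r * a + 1 := by rw [← hsum]; linear_combination -hmul
    have hb' : b ^ 2 = r * b + 1 := by rw [← hsum]; linear_combination -hmul
    simp only [isingF, eval₂_add, eval₂_mul, eval₂_X, ih₁, ih₂]
    linear_combination
      -(1 + a ^ 2)⁻¹ * a ^ n * ha' - (1 + b ^ 2)⁻¹ * b ^ n * hb'

/-- The product over vertices of `x i ^ deg i` as a product over edges. -/
theorem prod_pow_degIn {V : Type*} [Fintype V] [DecidableEq V] (s : Finset (Sym2 V))
    (x : V → ℝ) :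
    ∏ i, x i ^ degIn s i = ∏ e ∈ s, ∏ i, if i ∈ e then x i else 1 := by
  rw [Finset.prod_comm]
  refine Finset.prod_congr rfl fun i _ => ?_
  rw [degIn, ← Finset.prod_filter, Finset.prod_const]

theorem prod_ite_mem_sym2 {V : Type*} [Fintype V] [DecidableEq V] {i j : V} (hij : i ≠ j)
    (x : V → ℝ) : (∏ k, if k ∈ s(i, j) then x k else 1) = x i * x j := by
  rw [← Finset.prod_filter, ← Finset.prod_pair hij]
  congr 1
  ext k
  simp

/-- Expanding the vertex weights as a two-state model in which edges joining distinct states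
have weight zero, only the constant states contribute. -/
theorem sum_powerset_prod_two_state {V : Type*} [Fintype V] [DecidableEq V]
    (G : SimpleGraph V) [DecidableRel G.Adj] (hconn : G.Connected) (c w : Bool → ℝ)
    (hw : w true * w false = -1) :
    ∑ s ∈ G.edgeFinset.powerset,
        ∏ i : V, (c true * w true ^ degIn s i + c false * w false ^ degIn s i)
      = ∑ t, c t ^ Fintype.card V * (1 + w t ^ 2) ^ G.edgeFinset.card := by
  have hedge : ∀ (σ : V → Bool) (i j : V), G.Adj i j →
      (∏ k, if k ∈ s(i, j) then w (σ k) else 1) = w (σ i) * w (σ j) :=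
    fun σ i j hij => prod_ite_mem_sym2 hij.ne (fun k => w (σ k))
  have hexpand : ∀ s : Finset (Sym2 V),
      ∏ i : V, (c true * w true ^ degIn s i + c false * w false ^ degIn s i)
        = ∑ σ : V → Bool, (∏ i, c (σ i)) * ∏ e ∈ s, ∏ i, if i ∈ e then w (σ i) else 1 := by
    intro s
    rw [Finset.prod_congr rfl fun i _ => (Fintype.sum_bool fun t => c t * w t ^ degIn s i).symm,
      Finset.prod_univ_sum, Fintype.piFinset_univ]
    refine Finset.sum_congr rfl fun σ _ => ?_
    rw [← prod_pow_degIn s (fun i => w (σ i)), Finset.prod_mul_distrib]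
  simp_rw [hexpand]
  rw [Finset.sum_comm]
  simp_rw [← Finset.mul_sum, ← Finset.prod_one_add]
  have := hconn.nonempty
  have hinj : Function.Injective (fun (t : Bool) (_ : V) => t) := Function.const_injective
  rw [← Finset.sum_subset (Finset.subset_univ (Finset.univ.map ⟨_, hinj⟩)), Finset.sum_map]
  · refine Finset.sum_congr rfl fun t _ => ?_
    simp only [Function.Embedding.coeFn_mk, Finset.prod_const, Finset.card_univ]
    congr 1
    rw [← Finset.prod_const]
    refine Finset.prod_congr rfl fun e he => ?_
    induction e with
    | h i j =>
      rw [SimpleGraph.mem_edgeFinset, SimpleGraph.mem_edgeSet] at he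
      rw [hedge (fun _ => t) i j he, sq]
  · intro σ _ hσ
    obtain ⟨i, j, hij, hne⟩ : ∃ i j, G.Adj i j ∧ σ i ≠ σ j := by
      by_contra! h
      have hreach : ∀ i j, G.Reachable i j → σ i = σ j := by
        rintro i j ⟨p⟩
        induction p with
        | nil => rfl
        | cons hadj _ ih => exact (h _ _ hadj).trans ih
      obtain ⟨v⟩ := hconn.nonempty
      refine hσ (Finset.mem_map.2 ⟨σ v, Finset.mem_univ _, ?_⟩)
      funext i
      exact hreach v i (hconn.preconnected v i)
    refine mul_eq_zero_of_right _
      (Finset.prod_eq_zero (i := s(i, j)) (by simpa using hij) ?_)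
    rw [hedge σ i j hij]
    rcases hi : σ i <;> rcases hj : σ j
    · simp_all
    · rw [mul_comm, hw, add_neg_cancel]
    · rw [hw, add_neg_cancel]
    · simp_all

/-- The sum depends only on the nullity `n`: it agrees with that of the bouquet of `n` loops. -/
theorem sum_powerset_prod_isingF {V : Type*} [Fintype V] [DecidableEq V]
    (G : SimpleGraph V) [DecidableRel G.Adj] (hconn : G.Connected)
    (n : ℕ) (hn : n + Fintype.card V = G.edgeFinset.card + 1) :
    ∑ s ∈ G.edgeFinset.powerset, ∏ i : V, isingF (degIn s i)
      = ∑ k ∈ Finset.range (n + 1), (n.choose k : Polynomial ℤ) * isingF (2 * k) := by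
  apply Polynomial.map_injective (Int.castRingHom ℝ) Int.cast_injective
  refine Polynomial.funext fun r => ?_
  obtain ⟨a, b, hsum, hmul⟩ : ∃ a b : ℝ, a + b = r ∧ a * b = -1 := by
    refine ⟨(r + √(r ^ 2 + 4)) / 2, (r - √(r ^ 2 + 4)) / 2, by ring, ?_⟩
    have := Real.sq_sqrt (show 0 ≤ r ^ 2 + 4 by positivity)
    linear_combination -this / 4
  have key := sum_powerset_prod_two_state G hconn (fun t => cond t (1 + a ^ 2)⁻¹ (1 + b ^ 2)⁻¹)
    (fun t => cond t a b) hmul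
  have hpow : ∀ x : ℝ, x ≠ 0 →
      x⁻¹ ^ Fintype.card V * x ^ G.edgeFinset.card = x⁻¹ * x ^ n := by
    intro x hx
    have h : x ^ n * x ^ Fintype.card V = x ^ G.edgeFinset.card * x := by
      rw [← pow_add, hn, pow_succ]
    rw [inv_pow]
    field_simp
    linarith
  simp only [cond_true, cond_false, Fintype.sum_bool] at key
  rw [hpow _ (by positivity), hpow _ (by positivity)] at key
  simp only [eval_map, eval₂_finsetSum, eval₂_finsetProd, eval₂_mul, eval₂_natCast,
    eval_isingF hsum hmul, key]
  simp_rw [mul_add, Finset.sum_add_distrib, mul_left_comm _ (_⁻¹ : ℝ), ← Finset.mul_sum]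
  congr 2
  · rw [add_comm 1, add_pow]
    exact Finset.sum_congr rfl fun k _ => by rw [one_pow, pow_mul]; ring
  · rw [add_comm 1, add_pow]
    exact Finset.sum_congr rfl fun k _ => by rw [one_pow, pow_mul]; ring

theorem isingF_odd_and_even (N k : ℕ) (hk : k ≤ N) :
    isingF (2 * k + 1) =
        ∑ l ∈ Finset.range (N + 1), ((k + l).choose (2 * l + 1) : Polynomial ℤ) * X ^ (2 * l + 1) ∧
      isingF (2 * k + 2) =
        ∑ l ∈ Finset.range (N + 1), ((k + l).choose (2 * l) : Polynomial ℤ) * X ^ (2 * l) := by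
  induction k with
  | zero =>
    constructor
    · rw [Finset.sum_eq_zero]
      · rfl
      · intro l _
        rw [Nat.choose_eq_zero_of_lt (by omega)]
        simp
    · rw [Finset.sum_range_succ', Finset.sum_eq_zero]
      · simp [isingF]
      · intro l _
        rw [Nat.choose_eq_zero_of_lt (by omega)]
        simp
  | succ k ih =>
    obtain ⟨ho, he⟩ := ih (by omega)
    have ho' : isingF (2 * (k + 1) + 1) = ∑ l ∈ Finset.range (N + 1),
        ((k + 1 + l).choose (2 * l + 1) : Polynomial ℤ) * X ^ (2 * l + 1) := by
      change X * isingF (2 * k + 2) + isingF (2 * k + 1) = _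
      rw [ho, he, Finset.mul_sum, ← Finset.sum_add_distrib]
      refine Finset.sum_congr rfl fun l _ => ?_
      rw [add_right_comm k 1 l, Nat.choose_succ_succ]
      push_cast
      ring
    refine ⟨ho', ?_⟩
    change X * isingF (2 * (k + 1) + 1) + isingF (2 * k + 2) = _
    rw [ho', he, Finset.sum_range_succ, Nat.choose_eq_zero_of_lt (by omega), Nat.cast_zero,
      zero_mul, add_zero, Finset.sum_range_succ' _ N, Finset.sum_range_succ' _ N, ← add_assoc,
      Finset.mul_sum, ← Finset.sum_add_distrib]
    congr 1
    · refine Finset.sum_congr rfl fun l _ => ?_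
      rw [show k + 1 + (l + 1) = k + l + 1 + 1 by ring, show 2 * (l + 1) = 2 * l + 1 + 1 by ring,
        Nat.choose_succ_succ (k + l + 1), show k + 1 + l = k + l + 1 by ring,
        show k + (l + 1) = k + l + 1 by ring]
      push_cast
      ring
    · simp

theorem Cnl_succ_eq_sum (m l : ℕ) :
    Cnl (m + 1) l = (if l = 0 then 1 else 0) +
      ∑ k ∈ Finset.range (m + 1), ((m + 1).choose (k + 1) : ℤ) * ((k + l).choose (2 * l) : ℤ) := by
  rw [Cnl]
  split_ifs with h
  · subst h
    have := Nat.sum_range_choose (m + 1)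
    rw [Finset.sum_range_succ'] at this
    simp only [Nat.choose_zero_right, mul_zero, Nat.cast_one, mul_one]
    exact_mod_cast (this.symm.trans (add_comm _ _))
  · rw [zero_add]
    have hs : Finset.Icc (l + 1) (m + 1) ⊆ Finset.Ico 1 (m + 2) := fun k => by
      simp only [Finset.mem_Icc, Finset.mem_Ico]
      omega
    rw [Finset.sum_subset hs, Finset.sum_Ico_eq_sum_range]
    · refine Finset.sum_congr rfl fun k _ => ?_
      rw [add_comm 1 k, show k + 1 + l - 1 = k + l by omega]
    · intro k hk hk'
      simp only [Finset.mem_Icc, Finset.mem_Ico] at hk hk'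
      rw [Nat.choose_eq_zero_of_lt (show k + l - 1 < 2 * l by omega), Nat.cast_zero, mul_zero]

theorem theta_one_gamma_coeffs {V : Type*} [Fintype V] [DecidableEq V]
    (G : SimpleGraph V) [DecidableRel G.Adj] (hconn : G.Connected)
    (n : ℕ) (hn : n + Fintype.card V = G.edgeFinset.card + 1) (hn1 : 1 ≤ n) :
    ∑ s ∈ G.edgeFinset.powerset, ∏ i : V, isingF (degIn s i)
      = ∑ l ∈ Finset.range n, Polynomial.C (Cnl n l) * X ^ (2 * l) := by
  obtain ⟨m, rfl⟩ : ∃ m, n = m + 1 := ⟨n - 1, by omega⟩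
  rw [sum_powerset_prod_isingF G hconn _ hn, Finset.sum_range_succ']
  have h : ∀ k ∈ Finset.range (m + 1), ((m + 1).choose (k + 1) : Polynomial ℤ) *
      isingF (2 * (k + 1)) = ∑ l ∈ Finset.range (m + 1), ((m + 1).choose (k + 1) : Polynomial ℤ) *
        (((k + l).choose (2 * l) : Polynomial ℤ) * X ^ (2 * l)) := fun k hk => by
    rw [mul_add, mul_one, (isingF_odd_and_even m k (by simpa [Nat.lt_succ_iff] using hk)).2,
      Finset.mul_sum]
  rw [Finset.sum_congr rfl h, Finset.sum_comm]
  simp only [Cnl_succ_eq_sum, map_add, add_mul, Finset.sum_add_distrib]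
  rw [add_comm]
  congr 1
  · rw [Finset.sum_eq_single 0] <;> simp +contextual [isingF]
  · refine Finset.sum_congr rfl fun l _ => ?_
    rw [map_sum, Finset.sum_mul]
    exact Finset.sum_congr rfl fun k _ => by simp [mul_assoc]
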